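/- Let C be an isotropic convex body in ℝⁿ and K an isotropic centrally symmetric convex body in ℝⁿ which is 2-convex with constant α. There is an absolute constant c > 0 such that for every s ≥ 1 and every t ∈ ℝˢ, ∫_C⋯∫_C ‖∑_{j=1}^s t_j x_j‖_K dx₁⋯dx_s ≤ (c L_C / √α) ‖t‖₂. -/

import Mathlib

open MeasureTheory Real
open scoped ENNReal RealInnerProductSpace

noncomputable section

/-- A convex body: compact, convex, with non-empty interior. -/
def IsConvexBody {n : ℕ} (C : Set (EuclideanSpace ℝ (Fin n))) : Prop :=
  Convex ℝ C ∧ IsCompact C ∧ (interior C).Nonempty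

/-- A centrally symmetric convex body. -/
def IsSymmConvexBody {n : ℕ} (C : Set (EuclideanSpace ℝ (Fin n))) : Prop :=
  Convex ℝ C ∧ IsCompact C ∧ (interior C).Nonempty ∧ C = -C

/-- `C` is isotropic with isotropic constant `L`. -/
def IsIsotropic {n : ℕ} (C : Set (EuclideanSpace ℝ (Fin n))) (L : ℝ) : Prop :=
  volume C = 1 ∧ (∫ x in C, x) = 0 ∧ 0 < L ∧
    ∀ ξ : EuclideanSpace ℝ (Fin n), ‖ξ‖ = 1 → (∫ x in C, ⟪x, ξ⟫ ^ 2) = L ^ 2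

/-- `K` is 2-convex with constant `α`: its modulus of convexity satisfies
`δ_K(ε) ≥ αε²` for `ε ∈ (0,2]`, spelled out pointwise. -/
def IsTwoConvex {n : ℕ} (K : Set (EuclideanSpace ℝ (Fin n))) (α : ℝ) : Prop :=
  ∀ ε : ℝ, 0 < ε → ε ≤ 2 →
    ∀ x y : EuclideanSpace ℝ (Fin n), gauge K x ≤ 1 → gauge K y ≤ 1 →
      ε ≤ gauge K (x - y) → α * ε ^ 2 ≤ 1 - gauge K ((1 / 2 : ℝ) • (x + y))

/-- The Euclidean norm of `t ∈ ℝˢ`. -/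
def euclNorm {s : ℕ} (t : Fin s → ℝ) : ℝ := Real.sqrt (∑ j, t j ^ 2)

open scoped Pointwise in
theorem volume_add_volume_le_of_isCompact {A B D : Set ℝ} (hA : IsCompact A) (hB : IsCompact B)
    (hA' : A.Nonempty) (hB' : B.Nonempty)
    (h : ∀ x ∈ A, ∀ y ∈ B, (1 / 2 : ℝ) • (x + y) ∈ D) :
    volume A + volume B ≤ 2 * volume D := by
  obtain ⟨a, haA, ha⟩ := hA.exists_isGreatest hA'
  obtain ⟨b, hbB, hb⟩ := hB.exists_isLeast hB'
  have hsub : (fun x => x + b) '' A ∪ (fun y => a + y) '' B ⊆ (2 : ℝ) • D := by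
    rintro _ (⟨x, hx, rfl⟩ | ⟨y, hy, rfl⟩)
    · exact ⟨_, h x hx b hbB, by simp⟩
    · exact ⟨_, h a haA y hy, by simp⟩
  have hinter : volume ((fun x => x + b) '' A ∩ (fun y => a + y) '' B) = 0 := by
    refine measure_mono_null (t := {a + b}) ?_ (by simp)
    rintro _ ⟨⟨x, hx, rfl⟩, ⟨y, hy, hxy⟩⟩
    have h1 := ha hx
    have h2 := hb hy
    simp only [Set.mem_singleton_iff] at hxy ⊢
    linarith
  have hmeas : MeasurableSet ((fun y => a + y) '' B) :=
    (hB.image (by fun_prop)).measurableSet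
  have hunion := measure_union_add_inter (μ := volume) ((fun x => x + b) '' A) hmeas
  rw [hinter, add_zero] at hunion
  have hvA : volume ((fun x => x + b) '' A) = volume A := by simp
  have hvB : volume ((fun y => a + y) '' B) = volume B := by simp
  calc volume A + volume B = volume ((fun x => x + b) '' A ∪ (fun y => a + y) '' B) := by
        rw [hunion, hvA, hvB]
    _ ≤ volume ((2 : ℝ) • D) := measure_mono hsub
    _ = 2 * volume D := by simp [Measure.addHaar_smul]

/-- The one-dimensional Brunn–Minkowski inequality. -/
theorem volume_add_volume_le {A B D : Set ℝ} (hA : MeasurableSet A) (hB : MeasurableSet B)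
    (hA' : A.Nonempty) (hB' : B.Nonempty)
    (h : ∀ x ∈ A, ∀ y ∈ B, (1 / 2 : ℝ) • (x + y) ∈ D) :
    volume A + volume B ≤ 2 * volume D := by
  obtain ⟨a, ha⟩ := hA'
  obtain ⟨b, hb⟩ := hB'
  rw [hA.measure_eq_iSup_isCompact, hB.measure_eq_iSup_isCompact]
  simp only [iSup_and']
  refine ENNReal.biSup_add_biSup_le' (p := fun K => K ⊆ A ∧ IsCompact K)
    (q := fun K => K ⊆ B ∧ IsCompact K) ⟨∅, by simp⟩ ⟨∅, by simp⟩ ?_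
  rintro K ⟨hKA, hK⟩ M ⟨hMB, hM⟩
  calc volume K + volume M ≤ volume (insert a K) + volume (insert b M) := by
        gcongr <;> exact Set.subset_insert _ _
    _ ≤ 2 * volume D := by
      refine volume_add_volume_le_of_isCompact (hK.insert a) (hM.insert b)
        (Set.insert_nonempty _ _) (Set.insert_nonempty _ _) fun x hx y hy => h x ?_ y ?_
      · exact Set.insert_subset ha hKA hx
      · exact Set.insert_subset hb hMB hy

theorem lintegral_eq_lintegral_meas_lt_of_le_one {f : ℝ → ℝ≥0∞} (hf : Measurable f)
    (hf1 : ∀ x, f x ≤ 1) :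
    ∫⁻ x, f x = ∫⁻ t in Set.Ioi (0 : ℝ), volume {x | ENNReal.ofReal t < f x} := by
  have hft : ∀ x, f x ≠ ∞ := fun x => ((hf1 x).trans_lt ENNReal.one_lt_top).ne
  have := lintegral_eq_lintegral_meas_lt (volume : Measure ℝ) (f := fun x => (f x).toReal)
    (Filter.Eventually.of_forall fun x => ENNReal.toReal_nonneg)
    hf.ennreal_toReal.aemeasurable
  simp_rw [ENNReal.ofReal_toReal (hft _)] at this
  rw [this]
  refine setLIntegral_congr_fun measurableSet_Ioi fun t ht => ?_
  simp only [ENNReal.ofReal_lt_iff_lt_toReal (le_of_lt ht) (hft _)]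

theorem lintegral_add_lintegral_le_of_iSup_eq_one {f g h : ℝ → ℝ≥0∞} (hf : Measurable f)
    (hg : Measurable g) (hh : Measurable h) (hf1 : ⨆ x, f x = 1) (hg1 : ⨆ x, g x = 1)
    (hfg : ∀ x y, f x * g y ≤ h ((1 / 2 : ℝ) • (x + y)) ^ 2) :
    (∫⁻ x, f x) + ∫⁻ x, g x ≤ 2 * ∫⁻ x, h x := by
  have hle : ∀ {u : ℝ → ℝ≥0∞}, ⨆ x, u x = 1 → ∀ x, u x ≤ 1 := fun hu x => hu ▸ le_iSup _ x
  calc (∫⁻ x, f x) + ∫⁻ x, g x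
      = ∫⁻ t in Set.Ioi (0 : ℝ), (volume {x | ENNReal.ofReal t < f x} +
          volume {x | ENNReal.ofReal t < g x}) := by
        rw [lintegral_eq_lintegral_meas_lt_of_le_one hf (hle hf1),
          lintegral_eq_lintegral_meas_lt_of_le_one hg (hle hg1), lintegral_add_left]
        refine Antitone.measurable fun s t hst => measure_mono fun x hx => ?_
        exact (ENNReal.ofReal_le_ofReal hst).trans_lt hx
    _ ≤ ∫⁻ t in Set.Ioi (0 : ℝ), 2 * volume {x | ENNReal.ofReal t < min (h x) 1} := by
        refine lintegral_mono fun t => ?_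
        dsimp only
        by_cases ht : ENNReal.ofReal t < 1
        · refine volume_add_volume_le (measurableSet_lt measurable_const hf)
            (measurableSet_lt measurable_const hg) (by exact lt_iSup_iff.1 (ht.trans_eq hf1.symm))
            (by exact lt_iSup_iff.1 (ht.trans_eq hg1.symm)) fun x hx y hy => lt_min ?_ ht
          refine lt_of_not_ge fun hle => ((ENNReal.mul_lt_mul hx hy).trans_le (hfg x y)).not_ge ?_
          rw [← sq]
          gcongr
        · have : ∀ {u : ℝ → ℝ≥0∞}, ⨆ x, u x = 1 → {x | ENNReal.ofReal t < u x} = ∅ := by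
            intro u hu
            refine Set.eq_empty_of_forall_notMem fun x hx => ht (lt_of_lt_of_le hx (hle hu x))
          simp [this hf1, this hg1]
    _ = 2 * ∫⁻ x, min (h x) 1 := by
        rw [lintegral_const_mul' _ _ (by simp),
          lintegral_eq_lintegral_meas_lt_of_le_one (hh.min measurable_const)
            fun x => min_le_right _ _]
    _ ≤ 2 * ∫⁻ x, h x := by
        gcongr
        exact min_le_left _ _

theorem ENNReal.mul_le_sq_of_add_le_two_mul {a b c : ℝ≥0∞} (h : a + b ≤ 2 * c) :
    a * b ≤ c ^ 2 := by
  rcases eq_or_ne c ∞ with rfl | hc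
  · simp
  have hab : a + b ≠ ∞ := ne_top_of_le_ne_top (by finiteness) h
  lift c to NNReal using hc
  lift a to NNReal using (ENNReal.add_ne_top.1 hab).1
  lift b to NNReal using (ENNReal.add_ne_top.1 hab).2
  norm_cast at h ⊢
  rw [← NNReal.coe_le_coe] at h ⊢
  push_cast at h ⊢
  nlinarith [sq_nonneg ((a : ℝ) - b), a.coe_nonneg, b.coe_nonneg, c.coe_nonneg]

theorem lintegral_mul_lintegral_le_of_iSup_ne_top {f g h : ℝ → ℝ≥0∞} (hf : Measurable f)
    (hg : Measurable g) (hh : Measurable h) (hf1 : ⨆ x, f x ≠ ∞) (hg1 : ⨆ x, g x ≠ ∞)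
    (hfg : ∀ x y, f x * g y ≤ h ((1 / 2 : ℝ) • (x + y)) ^ 2) :
    (∫⁻ x, f x) * ∫⁻ x, g x ≤ (∫⁻ x, h x) ^ 2 := by
  rcases eq_or_ne (⨆ x, f x) 0 with hf0 | hf0
  · simp [ENNReal.iSup_eq_zero.1 hf0]
  rcases eq_or_ne (⨆ x, g x) 0 with hg0 | hg0
  · simp [ENNReal.iSup_eq_zero.1 hg0]
  set a := ⨆ x, f x
  set b := ⨆ x, g x
  obtain ⟨c, hc⟩ : ∃ c : ℝ≥0∞, c ^ 2 = a * b := by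
    refine ⟨(NNReal.sqrt (a * b).toNNReal : ℝ≥0∞), ?_⟩
    rw [← ENNReal.coe_pow, NNReal.sq_sqrt, ENNReal.coe_toNNReal (ENNReal.mul_ne_top hf1 hg1)]
  have hab0 : a * b ≠ 0 := mul_ne_zero hf0 hg0
  have habt : a * b ≠ ∞ := ENNReal.mul_ne_top hf1 hg1
  have key := ENNReal.mul_le_sq_of_add_le_two_mul
    (lintegral_add_lintegral_le_of_iSup_eq_one (f := fun x => a⁻¹ * f x)
      (g := fun x => b⁻¹ * g x) (h := fun x => c⁻¹ * h x) (hf.const_mul _) (hg.const_mul _)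
      (hh.const_mul _) (by rw [← ENNReal.mul_iSup, ENNReal.inv_mul_cancel hf0 hf1])
      (by rw [← ENNReal.mul_iSup, ENNReal.inv_mul_cancel hg0 hg1]) fun x y => by
        rw [mul_pow, ← ENNReal.inv_pow, hc, ENNReal.mul_inv (.inl hf0) (.inl hf1),
          mul_mul_mul_comm]
        gcongr
        exact hfg x y)
  rw [lintegral_const_mul _ hf, lintegral_const_mul _ hg, lintegral_const_mul _ hh, mul_pow,
    ← ENNReal.inv_pow, hc, mul_mul_mul_comm, ← ENNReal.mul_inv (.inl hf0) (.inl hf1)] at key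
  have := mul_le_mul_right key (a * b)
  rwa [← mul_assoc, ENNReal.mul_inv_cancel hab0 habt, one_mul, ← mul_assoc,
    ENNReal.mul_inv_cancel hab0 habt, one_mul] at this

/-- The midpoint case of the Prékopa–Leindler inequality, as a property of a measure. -/
def SatisfiesPrekopaLeindler {E : Type*} [AddCommGroup E] [Module ℝ E] [MeasurableSpace E]
    (μ : Measure E) : Prop :=
  ∀ f g h : E → ℝ≥0∞, Measurable f → Measurable g → Measurable h →
    (∀ x y, f x * g y ≤ h ((1 / 2 : ℝ) • (x + y)) ^ 2) →
    (∫⁻ x, f x ∂μ) * ∫⁻ x, g x ∂μ ≤ (∫⁻ x, h x ∂μ) ^ 2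

theorem satisfiesPrekopaLeindler_real : SatisfiesPrekopaLeindler (volume : Measure ℝ) := by
  intro f g h hf hg hh hfg
  have hlim : ∀ {u : ℝ → ℝ≥0∞}, Measurable u →
      Filter.Tendsto (fun k : ℕ => ∫⁻ x, min (u x) k) Filter.atTop (nhds (∫⁻ x, u x)) := by
    intro u hu
    refine lintegral_tendsto_of_tendsto_of_monotone (fun k => (hu.min measurable_const).aemeasurable)
      (Filter.Eventually.of_forall fun x k l hkl => ?_) (Filter.Eventually.of_forall fun x => ?_)
    · exact min_le_min_left _ (by exact_mod_cast hkl)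
    · simpa using (tendsto_const_nhds (x := u x)).min ENNReal.tendsto_nat_nhds_top
  have hb : ∀ (u : ℝ → ℝ≥0∞) (k : ℕ), ⨆ x, min (u x) k ≠ ∞ := fun u k =>
    ne_top_of_le_ne_top (ENNReal.natCast_ne_top k) (iSup_le fun x => min_le_right _ _)
  have hk : ∀ k : ℕ, (∫⁻ x, min (f x) k) * ∫⁻ x, min (g x) k ≤ (∫⁻ x, h x) ^ 2 := fun k =>
    lintegral_mul_lintegral_le_of_iSup_ne_top (hf.min measurable_const) (hg.min measurable_const)
      hh (hb f k) (hb g k) fun x y => (mul_le_mul' (min_le_left _ _) (min_le_left _ _)).trans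
        (hfg x y)
  have hmono : ∀ {u : ℝ → ℝ≥0∞} (k : ℕ), ∫⁻ x, min (u x) k ≤ ∫⁻ x, u x := fun k =>
    lintegral_mono fun x => min_le_left _ _
  rcases eq_or_ne (∫⁻ x, f x) 0 with hf0 | hf0
  · simp [hf0]
  rcases eq_or_ne (∫⁻ x, g x) 0 with hg0 | hg0
  · simp [hg0]
  exact le_of_tendsto' (ENNReal.Tendsto.mul (hlim hf) (.inl hf0) (hlim hg) (.inl hg0)) hk

theorem SatisfiesPrekopaLeindler.prod {E F : Type*} [AddCommGroup E] [Module ℝ E]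
    [MeasurableSpace E] [AddCommGroup F] [Module ℝ F] [MeasurableSpace F] {μ : Measure E}
    {ν : Measure F} [SFinite μ] [SFinite ν] (hμ : SatisfiesPrekopaLeindler μ)
    (hν : SatisfiesPrekopaLeindler ν) : SatisfiesPrekopaLeindler (μ.prod ν) := by
  intro f g h hf hg hh hfg
  rw [lintegral_prod _ hf.aemeasurable, lintegral_prod _ hg.aemeasurable,
    lintegral_prod _ hh.aemeasurable]
  refine hμ _ _ _ hf.lintegral_prod_right' hg.lintegral_prod_right' hh.lintegral_prod_right'
    fun x y => ?_
  exact hν _ _ _ (hf.comp measurable_prodMk_left) (hg.comp measurable_prodMk_left)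
    (hh.comp measurable_prodMk_left) fun u v => hfg (x, u) (y, v)

theorem SatisfiesPrekopaLeindler.of_measurePreserving {E F : Type*} [AddCommGroup E] [Module ℝ E]
    [MeasurableSpace E] [AddCommGroup F] [Module ℝ F] [MeasurableSpace F] {μ : Measure E}
    {ν : Measure F} (hμ : SatisfiesPrekopaLeindler μ) {φ : E → F} (hφ : MeasurePreserving φ μ ν)
    (hadd : ∀ x y, φ ((1 / 2 : ℝ) • (x + y)) = (1 / 2 : ℝ) • (φ x + φ y)) :
    SatisfiesPrekopaLeindler ν := by
  intro f g h hf hg hh hfg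
  rw [← hφ.lintegral_comp hf, ← hφ.lintegral_comp hg, ← hφ.lintegral_comp hh]
  exact hμ _ _ _ (hf.comp hφ.measurable) (hg.comp hφ.measurable) (hh.comp hφ.measurable)
    fun x y => by simpa only [Function.comp_apply, hadd] using hfg (φ x) (φ y)

theorem satisfiesPrekopaLeindler_pi (n : ℕ) :
    SatisfiesPrekopaLeindler (volume : Measure (Fin n → ℝ)) := by
  induction n with
  | zero =>
    intro f g h _ _ _ hfg
    simp only [Measure.volume_pi_eq_dirac 0, lintegral_dirac]
    simpa using hfg 0 0
  | succ n ih =>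
    refine (satisfiesPrekopaLeindler_real.prod ih).of_measurePreserving
      (volume_preserving_piFinSuccAbove (fun _ : Fin (n + 1) => ℝ) 0).symm fun x y => ?_
    ext i
    refine Fin.cases ?_ (fun j => ?_) i <;> simp [MeasurableEquiv.piFinSuccAbove, mul_add]

theorem satisfiesPrekopaLeindler_euclideanSpace (n : ℕ) :
    SatisfiesPrekopaLeindler (volume : Measure (EuclideanSpace ℝ (Fin n))) :=
  (satisfiesPrekopaLeindler_pi n).of_measurePreserving (PiLp.volume_preserving_toLp (Fin n))
    fun x y => by simp

theorem volume_mul_volume_le {n : ℕ} {A B D : Set (EuclideanSpace ℝ (Fin n))}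
    (hA : MeasurableSet A) (hB : MeasurableSet B) (hD : MeasurableSet D)
    (h : ∀ x ∈ A, ∀ y ∈ B, (1 / 2 : ℝ) • (x + y) ∈ D) :
    volume A * volume B ≤ volume D ^ 2 := by
  have := satisfiesPrekopaLeindler_euclideanSpace n (A.indicator 1) (B.indicator 1)
    (D.indicator 1) (measurable_one.indicator hA) (measurable_one.indicator hB)
    (measurable_one.indicator hD) fun x y => by
      by_cases hx : x ∈ A
      · by_cases hy : y ∈ B
        · simp only [Set.indicator_of_mem hx, Set.indicator_of_mem hy,
            Set.indicator_of_mem (h x hx y hy), Pi.one_apply, one_pow, mul_one, le_refl]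
        · simp [hy]
      · simp [hx]
  simpa only [lintegral_indicator_one hA, lintegral_indicator_one hB,
    lintegral_indicator_one hD] using this

theorem IsSymmConvexBody.mem_nhds_zero {n : ℕ} {K : Set (EuclideanSpace ℝ (Fin n))}
    (hK : IsSymmConvexBody K) : K ∈ nhds 0 := by
  obtain ⟨hconv, -, ⟨x, hx⟩, hsymm⟩ := hK
  have hneg : -x ∈ K := by
    rw [hsymm]
    simpa using interior_subset hx
  have := hconv.combo_interior_self_mem_interior hx hneg (a := 1 / 2) (b := 1 / 2)
    (by norm_num) (by norm_num) (by norm_num)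
  simpa [mem_interior_iff_mem_nhds] using this

theorem inner_le_mul_gauge {n : ℕ} {K : Set (EuclideanSpace ℝ (Fin n))} (hK : K ∈ nhds 0)
    {θ : EuclideanSpace ℝ (Fin n)} {M : ℝ} (hM : ∀ x ∈ K, ⟪x, θ⟫ ≤ M)
    (z : EuclideanSpace ℝ (Fin n)) : ⟪z, θ⟫ ≤ M * gauge K z := by
  have hM0 : 0 ≤ M := by simpa using hM 0 (mem_of_mem_nhds hK)
  refine ge_of_tendsto (f := fun r => M * r) (x := nhdsWithin (gauge K z) (Set.Ioi (gauge K z)))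
    (((continuous_const_mul M).tendsto _).mono_left nhdsWithin_le_nhds) ?_
  filter_upwards [self_mem_nhdsWithin] with r hr
  obtain ⟨b, hb, hbr, k, hk, rfl⟩ := exists_lt_of_gauge_lt (absorbent_nhds_zero hK) hr
  simp only [real_inner_smul_left]
  nlinarith [hM k hk]

open scoped Pointwise in
/-- Concentration of volume of a 2-convex body away from the caps orthogonal to `θ`. -/
theorem volume_cap_le {n : ℕ} {K : Set (EuclideanSpace ℝ (Fin n))} (hK : IsSymmConvexBody K)
    (hvol : volume K = 1) {α : ℝ} (hK2 : IsTwoConvex K α) {θ : EuclideanSpace ℝ (Fin n)} {M τ : ℝ}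
    (hM : ∀ x ∈ K, ⟪x, θ⟫ ≤ M) (hτ : 0 < τ) :
    volume {x | x ∈ K ∧ τ ≤ ⟪x, θ⟫} ≤
      ENNReal.ofReal (Real.exp (-(4 * α * n / M ^ 2) * τ ^ 2)) := by
  have hnhds := hK.mem_nhds_zero
  obtain ⟨hconv, hcomp, -, hsymm⟩ := hK
  have hneg : ∀ x ∈ K, -x ∈ K := fun x hx => by
    rw [hsymm]
    simpa using hx
  set A := {x | x ∈ K ∧ τ ≤ ⟪x, θ⟫}
  rcases A.eq_empty_or_nonempty with hAe | ⟨p, hpK, hp⟩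
  · simp [hAe]
  have hMτ : τ ≤ M := hp.trans (hM p hpK)
  have hM0 : 0 < M := hτ.trans_le hMτ
  have hAm : MeasurableSet A :=
    (hcomp.isClosed.inter (isClosed_le (f := fun _ => τ) (g := fun x => ⟪x, θ⟫) continuous_const
      (by fun_prop))).measurableSet
  set δ := α * (2 * τ / M) ^ 2 with hδ
  have hmid : ∀ x ∈ A, ∀ y ∈ -A, (1 / 2 : ℝ) • (x + y) ∈ Real.exp (-δ) • K := by
    rintro x ⟨hxK, hx⟩ y ⟨hyK, hy⟩
    have hyK' : y ∈ K := by simpa using hneg _ hyK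
    have hxy : 2 * τ / M ≤ gauge K (x - y) := by
      rw [div_le_iff₀' hM0]
      refine le_trans ?_ (inner_le_mul_gauge hnhds hM _)
      rw [inner_sub_left]
      rw [inner_neg_left] at hy
      linarith
    have h := hK2 (2 * τ / M) (by positivity) (by rw [div_le_iff₀ hM0]; linarith) x y
      (gauge_le_one_of_mem hxK) (gauge_le_one_of_mem hyK') hxy
    have hexp := Real.add_one_le_exp (-δ)
    rw [Set.mem_smul_set_iff_inv_smul_mem₀ (Real.exp_pos _).ne', ← hcomp.isClosed.closure_eq,
      ← gauge_le_one_iff_mem_closure hconv hnhds,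
      gauge_smul_of_nonneg (inv_nonneg.2 (Real.exp_pos _).le), smul_eq_mul,
      inv_mul_le_one₀ (Real.exp_pos _)]
    linarith
  have h := volume_mul_volume_le hAm hAm.neg
    (hcomp.smul (Real.exp (-δ))).isClosed.measurableSet hmid
  rw [Measure.measure_neg, ← sq] at h
  refine ((ENNReal.pow_le_pow_left_iff two_ne_zero).1 h).trans_eq ?_
  rw [Measure.addHaar_smul, hvol, mul_one, finrank_euclideanSpace_fin,
    abs_of_pos (by positivity), ← Real.exp_nat_mul]
  congr 2
  rw [hδ]
  field_simp
  ring

theorem setIntegral_inner_sq_le {n : ℕ} (hn : n ≠ 0) {K : Set (EuclideanSpace ℝ (Fin n))}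
    (hK : IsSymmConvexBody K) (hvol : volume K = 1) {α : ℝ} (hα : 0 < α) (hK2 : IsTwoConvex K α)
    {θ : EuclideanSpace ℝ (Fin n)} {M : ℝ} (hM0 : 0 < M) (hM : ∀ x ∈ K, ⟪x, θ⟫ ≤ M) :
    (∫ x in K, ⟪x, θ⟫ ^ 2) ≤ M ^ 2 / (2 * α * n) := by
  have hn0 : (0 : ℝ) < n := by positivity
  set κ := 4 * α * n / M ^ 2 with hκ
  have hκ0 : 0 < κ := by positivity
  have hM' : ∀ x ∈ K, ⟪x, -θ⟫ ≤ M := fun x hx => by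
    have hx' : -x ∈ K := by
      rw [hK.2.2.2]
      simpa using hx
    simpa using hM _ hx'
  rw [integral_eq_lintegral_of_nonneg_ae (Filter.Eventually.of_forall fun x => sq_nonneg _)
    (by fun_prop)]
  refine ENNReal.toReal_le_of_le_ofReal (by positivity) ?_
  rw [lintegral_eq_lintegral_meas_lt _ (Filter.Eventually.of_forall fun x => sq_nonneg _)
    (by fun_prop)]
  calc ∫⁻ s in Set.Ioi (0 : ℝ), volume.restrict K {x | s < ⟪x, θ⟫ ^ 2}
      ≤ ∫⁻ s in Set.Ioi (0 : ℝ), 2 * ENNReal.ofReal (Real.exp (-κ * s)) := by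
        refine setLIntegral_mono' measurableSet_Ioi fun s hs => ?_
        have hs : 0 < s := hs
        rw [Measure.restrict_apply (measurableSet_lt measurable_const (by fun_prop))]
        have hsub : {x | s < ⟪x, θ⟫ ^ 2} ∩ K ⊆
            {x | x ∈ K ∧ √s ≤ ⟪x, θ⟫} ∪ {x | x ∈ K ∧ √s ≤ ⟪x, -θ⟫} := by
          rintro x ⟨hx, hxK⟩
          have : √s ≤ |⟪x, θ⟫| := Real.sqrt_le_iff.2 ⟨abs_nonneg _, by
            rw [sq_abs]
            exact le_of_lt hx⟩
          rcases le_abs.1 this with h | h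
          · exact .inl ⟨hxK, h⟩
          · exact .inr ⟨hxK, by rwa [inner_neg_right]⟩
        refine (measure_mono hsub).trans ((measure_union_le _ _).trans ?_)
        have h1 := volume_cap_le hK hvol hK2 hM (Real.sqrt_pos.2 hs)
        have h2 := volume_cap_le hK hvol hK2 hM' (Real.sqrt_pos.2 hs)
        rw [Real.sq_sqrt hs.le] at h1 h2
        rw [two_mul]
        exact add_le_add h1 h2
    _ = ENNReal.ofReal (M ^ 2 / (2 * α * n)) := by
        rw [lintegral_const_mul' _ _ (by simp), ← ofReal_integral_eq_lintegral_ofReal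
          (integrableOn_exp_mul_Ioi (by linarith) 0)
          (Filter.Eventually.of_forall fun x => (Real.exp_pos _).le),
          integral_exp_mul_Ioi (by linarith), ← ENNReal.ofReal_ofNat,
          ← ENNReal.ofReal_mul (by norm_num)]
        congr 1
        simp only [mul_zero, Real.exp_zero, hκ]
        field_simp
        ring

theorem setIntegral_norm_sq_of_isIsotropic {n : ℕ} {C : Set (EuclideanSpace ℝ (Fin n))}
    (hcomp : IsCompact C) {L : ℝ} (hC : IsIsotropic C L) :
    (∫ x in C, ‖x‖ ^ 2) = n * L ^ 2 := by
  have hsum : ∀ x : EuclideanSpace ℝ (Fin n),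
      ‖x‖ ^ 2 = ∑ i, ⟪x, EuclideanSpace.basisFun (Fin n) ℝ i⟫ ^ 2 := fun x => by
    rw [← (EuclideanSpace.basisFun (Fin n) ℝ).sum_sq_norm_inner_left x]
    simp only [Real.norm_eq_abs, sq_abs]
  simp_rw [hsum]
  rw [integral_finsetSum _ fun i _ => ContinuousOn.integrableOn_compact hcomp (by fun_prop)]
  rw [Finset.sum_congr rfl fun i _ => hC.2.2.2 _ ((EuclideanSpace.basisFun (Fin n) ℝ).norm_eq_one i)]
  simp

theorem one_div_twenty_le_sq_of_isIsotropic {n : ℕ} (hn : n ≠ 0)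
    {K : Set (EuclideanSpace ℝ (Fin n))} (hcomp : IsCompact K) {L : ℝ} (hK : IsIsotropic K L) :
    1 / 20 ≤ L ^ 2 := by
  have hn0 : (0 : ℝ) < n := by positivity
  have hm := setIntegral_norm_sq_of_isIsotropic hcomp hK
  set b : ℝ := 4 * π with hb
  have hb0 : 0 < b := by positivity
  set m : ℝ := n * L ^ 2 with hm'
  have hgauss := GaussianFourier.integral_rexp_neg_mul_sq_norm
    (V := EuclideanSpace ℝ (Fin n)) hb0
  have hint : Integrable (fun v : EuclideanSpace ℝ (Fin n) => Real.exp (-b * ‖v‖ ^ 2)) := by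
    by_contra hcon
    rw [integral_undef hcon] at hgauss
    exact (Real.rpow_pos_of_pos (by positivity) _).ne hgauss
  have hval : (∫ x in K, Real.exp (-b * m) * (1 - b * (‖x‖ ^ 2 - m))) = Real.exp (-b * m) := by
    have h2 : IntegrableOn (fun x : EuclideanSpace ℝ (Fin n) => ‖x‖ ^ 2) K :=
      ContinuousOn.integrableOn_compact hcomp (by fun_prop)
    have hfin : volume K ≠ ∞ := by simp [hK.1]
    have hc : ∀ r : ℝ, IntegrableOn (fun _ : EuclideanSpace ℝ (Fin n) => r) K :=
      fun r => integrableOn_const hfin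
    have h3 : IntegrableOn (fun x : EuclideanSpace ℝ (Fin n) => ‖x‖ ^ 2 - m) K := h2.sub (hc m)
    rw [integral_const_mul, integral_sub (hc 1) (h3.const_mul b), integral_const_mul,
      integral_sub h2 (hc m), hm]
    simp [hK.1, Measure.real]
  have hle : Real.exp (-b * m) ≤ (π / b) ^ (n / 2 : ℝ) := by
    calc Real.exp (-b * m) = ∫ x in K, Real.exp (-b * m) * (1 - b * (‖x‖ ^ 2 - m)) := hval.symm
      _ ≤ ∫ x in K, Real.exp (-b * ‖x‖ ^ 2) := by
        refine integral_mono (ContinuousOn.integrableOn_compact hcomp (by fun_prop))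
          hint.integrableOn fun x => ?_
        have h := Real.add_one_le_exp (-b * (‖x‖ ^ 2 - m))
        calc Real.exp (-b * m) * (1 - b * (‖x‖ ^ 2 - m))
            ≤ Real.exp (-b * m) * Real.exp (-b * (‖x‖ ^ 2 - m)) := by
              gcongr
              linarith
          _ = Real.exp (-b * ‖x‖ ^ 2) := by
              rw [← Real.exp_add]
              ring_nf
      _ ≤ ∫ x, Real.exp (-b * ‖x‖ ^ 2) :=
        setIntegral_le_integral hint (Filter.Eventually.of_forall fun x => (Real.exp_pos _).le)
      _ = (π / b) ^ (n / 2 : ℝ) := by rw [hgauss, finrank_euclideanSpace_fin]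
  have hquarter : π / b = 1 / 4 := by
    rw [hb]
    field_simp
  have hlog := Real.log_le_log (Real.exp_pos _) hle
  have hl4 : Real.log (1 / 4) = -(2 * Real.log 2) := by
    rw [one_div, Real.log_inv, show (4 : ℝ) = 2 ^ 2 by norm_num, Real.log_pow]
    norm_num
  rw [Real.log_exp, Real.log_rpow (by positivity), hquarter, hl4] at hlog
  have h1 : n * Real.log 2 ≤ n * (b * L ^ 2) := by
    rw [hm'] at hlog
    linarith
  have h2 : Real.log 2 ≤ 4 * π * L ^ 2 := le_of_mul_le_mul_left h1 hn0
  nlinarith [Real.log_two_gt_d9, Real.pi_lt_d2, sq_nonneg L]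

/-- An isotropic 2-convex body contains a Euclidean ball of radius of order `√(αn)`. -/
theorem closedBall_subset_of_isTwoConvex {n : ℕ} (hn : n ≠ 0)
    {K : Set (EuclideanSpace ℝ (Fin n))} (hK : IsSymmConvexBody K) {L : ℝ} (hKiso : IsIsotropic K L)
    {α : ℝ} (hα : 0 < α) (hK2 : IsTwoConvex K α) :
    Metric.closedBall 0 (√(α * n) / 4) ⊆ K := by
  intro x hx
  rw [mem_closedBall_zero_iff] at hx
  by_contra hxK
  have hn0 : (0 : ℝ) < n := by positivity
  obtain ⟨f, u, hfK, hfx⟩ := geometric_hahn_banach_closed_point hK.1 hK.2.1.isClosed hxK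
  have hu : 0 < u := by simpa using hfK 0 (mem_of_mem_nhds hK.mem_nhds_zero)
  set v := (InnerProductSpace.toDual ℝ (EuclideanSpace ℝ (Fin n))).symm f with hv
  have hfv : ∀ y, f y = ⟪y, v⟫ := fun y => by
    rw [real_inner_comm, hv, InnerProductSpace.toDual_symm_apply]
  have hv0 : 0 < ‖v‖ := by
    rw [norm_pos_iff]
    intro h
    rw [hfv, h, inner_zero_right] at hfx
    linarith
  have hθ : ∀ y, ⟪y, ‖v‖⁻¹ • v⟫ = f y / ‖v‖ := fun y => by
    rw [real_inner_smul_right, hfv]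
    ring
  have hnorm : ‖‖v‖⁻¹ • v‖ = 1 := by
    rw [norm_smul, norm_inv, norm_norm, inv_mul_cancel₀ hv0.ne']
  have hM0 : 0 < u / ‖v‖ := by positivity
  have hmom := setIntegral_inner_sq_le hn hK hKiso.1 hα hK2 (θ := ‖v‖⁻¹ • v) hM0 fun y hy => by
    rw [hθ]
    gcongr
    exact (hfK y hy).le
  rw [hKiso.2.2.2 _ hnorm, le_div_iff₀ (by positivity)] at hmom
  have hL := one_div_twenty_le_sq_of_isIsotropic hn hK.2.1 hKiso
  have hlt : u / ‖v‖ < √(α * n) / 4 := by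
    calc u / ‖v‖ < f x / ‖v‖ := by gcongr
      _ = ⟪x, ‖v‖⁻¹ • v⟫ := (hθ x).symm
      _ ≤ ‖x‖ * ‖‖v‖⁻¹ • v‖ := real_inner_le_norm _ _
      _ ≤ √(α * n) / 4 := by rwa [hnorm, mul_one]
  have hsq : (u / ‖v‖) ^ 2 < α * n / 16 := by
    calc (u / ‖v‖) ^ 2 < (√(α * n) / 4) ^ 2 := by gcongr
      _ = α * n / 16 := by
        rw [div_pow, Real.sq_sqrt (by positivity)]
        norm_num
  have hαn : 0 < α * n := by positivity
  nlinarith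

theorem integral_norm_sq_sum_smul {n s : ℕ} {C : Set (EuclideanSpace ℝ (Fin n))}
    (hcomp : IsCompact C) {L : ℝ} (hC : IsIsotropic C L) (t : Fin s → ℝ) :
    (∫ x in Set.univ.pi fun _ : Fin s => C, ‖∑ j, t j • x j‖ ^ 2) = n * L ^ 2 * ∑ j, t j ^ 2 := by
  have : IsProbabilityMeasure (volume.restrict C) := ⟨by simp [hC.1]⟩
  rw [volume_pi, Measure.restrict_pi_pi]
  set e := EuclideanSpace.basisFun (Fin n) ℝ
  have hsum : ∀ x : EuclideanSpace ℝ (Fin n), ‖x‖ ^ 2 = ∑ i, ⟪x, e i⟫ ^ 2 := fun x => by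
    rw [← e.sum_sq_norm_inner_left x]
    simp only [Real.norm_eq_abs, sq_abs]
  have hL2 : ∀ i (j : Fin s), MemLp (fun y => t j * ⟪y, e i⟫) 2 (volume.restrict C) := fun i j =>
    (memLp_two_iff_integrable_sq (by fun_prop)).2
      (ContinuousOn.integrableOn_compact hcomp (by fun_prop))
  have hid : IntegrableOn (fun y : EuclideanSpace ℝ (Fin n) => y) C :=
    continuousOn_id.integrableOn_compact hcomp
  have hmean : ∀ i, (∫ y in C, ⟪y, e i⟫) = 0 := fun i => by
    simp_rw [real_inner_comm (e i)]
    rw [integral_inner hid, hC.2.1, inner_zero_right]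
  have hmem : ∀ i j, MemLp (fun x : Fin s → EuclideanSpace ℝ (Fin n) => t j * ⟪x j, e i⟫) 2
      (Measure.pi fun _ => volume.restrict C) := fun i j =>
    (hL2 i j).comp_measurePreserving (measurePreserving_eval _ j)
  have hcoord : ∀ i, (∫ x : Fin s → EuclideanSpace ℝ (Fin n), ⟪∑ j, t j • x j, e i⟫ ^ 2
      ∂Measure.pi fun _ => volume.restrict C) = L ^ 2 * ∑ j, t j ^ 2 := fun i => by
    have hvar := ProbabilityTheory.variance_sum_pi (hL2 i)
    have hfun : (∑ j, fun x : Fin s → EuclideanSpace ℝ (Fin n) => t j * ⟪x j, e i⟫) =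
        fun x => ⟪∑ j, t j • x j, e i⟫ := by
      ext x
      simp [sum_inner, real_inner_smul_left]
    rw [hfun, ProbabilityTheory.variance_of_integral_eq_zero
      (Continuous.aemeasurable (by fun_prop))] at hvar
    · rw [hvar, Finset.mul_sum]
      refine Finset.sum_congr rfl fun j _ => ?_
      rw [ProbabilityTheory.variance_of_integral_eq_zero (by fun_prop)
        (by rw [integral_const_mul, hmean, mul_zero])]
      simp_rw [mul_pow]
      rw [integral_const_mul, hC.2.2.2 _ (e.norm_eq_one i), mul_comm]
    · simp_rw [sum_inner, real_inner_smul_left]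
      rw [integral_finsetSum _ fun j _ => (hmem i j).integrable (by norm_num)]
      refine Finset.sum_eq_zero fun j _ => ?_
      rw [integral_comp_eval (μ := fun _ : Fin s => volume.restrict C)
        (f := fun y => t j * ⟪y, e i⟫) (by fun_prop), integral_const_mul, hmean, mul_zero]
  simp_rw [hsum]
  rw [integral_finsetSum]
  · simp_rw [hcoord]
    simp [mul_assoc]
  · intro i _
    refine MemLp.integrable_sq ?_
    simp_rw [sum_inner, real_inner_smul_left]
    exact memLp_finsetSum _ fun j _ => hmem i j

/-- there is an absolute constant `c > 0` such that for any isotropic convex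
body `C` in `ℝⁿ` and any isotropic centrally symmetric convex body `K` which is 2-convex
with constant `α`, for every `s ≥ 1` and `t ∈ ℝˢ`,
`∫_C⋯∫_C ‖∑ t_j x_j‖_K ≤ (c L_C / √α) ‖t‖₂`. -/
theorem stmt7 :
    ∃ c : ℝ, 0 < c ∧
      ∀ (n s : ℕ) (_hs : 1 ≤ s)
        (C : Set (EuclideanSpace ℝ (Fin n))) (_hC : IsConvexBody C)
        (L : ℝ) (_hCiso : IsIsotropic C L)
        (K : Set (EuclideanSpace ℝ (Fin n))) (_hK : IsSymmConvexBody K)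
        (LK : ℝ) (_hKiso : IsIsotropic K LK)
        (α : ℝ) (_hα : 0 < α) (_hK2 : IsTwoConvex K α)
        (t : Fin s → ℝ),
        (∫ x in Set.univ.pi fun _ : Fin s => C, gauge K (∑ j, t j • x j))
          ≤ c * L / Real.sqrt α * euclNorm t := by
  refine ⟨4, by norm_num, ?_⟩
  intro n s _ C hC L hCiso K hK LK hKiso α hα hK2 t
  have hL : 0 < L := hCiso.2.2.1
  have ht : 0 ≤ euclNorm t := Real.sqrt_nonneg _
  rcases eq_or_ne n 0 with rfl | hn
  · have h0 : ∀ x : EuclideanSpace ℝ (Fin 0), gauge K x = 0 := fun x => by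
      rw [Subsingleton.elim x 0, gauge_zero]
    simp only [h0, integral_zero]
    positivity
  have hn0 : (0 : ℝ) < n := by positivity
  set r := √(α * n) / 4 with hr
  have hr0 : 0 < r := by positivity
  have hball := closedBall_subset_of_isTwoConvex hn hK hKiso hα hK2
  have hgauge : ∀ z, gauge K z ≤ r⁻¹ * ‖z‖ := fun z => by
    rw [inv_mul_eq_div, le_div_iff₀' hr0]
    exact mul_gauge_le_norm (Metric.ball_subset_closedBall.trans hball)
  have hcomp : IsCompact (Set.univ.pi fun _ : Fin s => C) := isCompact_univ_pi fun _ => hC.2.1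
  have : IsProbabilityMeasure (volume.restrict (Set.univ.pi fun _ : Fin s => C)) :=
    ⟨by simp [volume_pi_pi, hCiso.1]⟩
  have hcont := continuous_gauge hK.1 hK.mem_nhds_zero
  have hmono : (∫ x in Set.univ.pi fun _ : Fin s => C, gauge K (∑ j, t j • x j)) ≤
      r⁻¹ * ∫ x in Set.univ.pi fun _ : Fin s => C, ‖∑ j, t j • x j‖ := by
    rw [← integral_const_mul]
    exact integral_mono (ContinuousOn.integrableOn_compact hcomp (Continuous.continuousOn (by fun_prop)))
      (ContinuousOn.integrableOn_compact hcomp (Continuous.continuousOn (by fun_prop))) fun x => hgauge _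
  have hsq : (∫ x in Set.univ.pi fun _ : Fin s => C, ‖∑ j, t j • x j‖) ^ 2 ≤
      n * L ^ 2 * ∑ j, t j ^ 2 := by
    rw [← integral_norm_sq_sum_smul hC.2.1 hCiso t]
    have hmem : MemLp (fun x : Fin s → EuclideanSpace ℝ (Fin n) => ‖∑ j, t j • x j‖) 2
        (volume.restrict (Set.univ.pi fun _ : Fin s => C)) :=
      (memLp_two_iff_integrable_sq (Continuous.aestronglyMeasurable (by fun_prop))).2
        (ContinuousOn.integrableOn_compact hcomp (Continuous.continuousOn (by fun_prop)))
    have := ProbabilityTheory.variance_nonneg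
      (fun x : Fin s → EuclideanSpace ℝ (Fin n) => ‖∑ j, t j • x j‖)
      (volume.restrict (Set.univ.pi fun _ : Fin s => C))
    rw [ProbabilityTheory.variance_eq_sub hmem] at this
    simpa using this
  have hnorm : (∫ x in Set.univ.pi fun _ : Fin s => C, ‖∑ j, t j • x j‖) ≤
      √n * L * euclNorm t := by
    refine le_of_sq_le_sq ?_ (by positivity)
    rw [mul_pow, mul_pow, Real.sq_sqrt hn0.le, euclNorm,
      Real.sq_sqrt (Finset.sum_nonneg fun j _ => sq_nonneg _)]
    exact hsq
  calc _ ≤ r⁻¹ * (√n * L * euclNorm t) := hmono.trans (by gcongr)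
    _ = 4 * L / √α * euclNorm t := by
      rw [hr, Real.sqrt_mul hα.le]
      have := Real.sqrt_pos.2 hn0
      have := Real.sqrt_pos.2 hα
      field_simp
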